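/- arXiv:math/0611673 — 2 statements merged into one kernel-verified Lean document; each statement's English description precedes it below -/
import Mathlib

section
/- For any field K and any integer n ≥ 5, ed_K(S_n) ≤ n − 3. -/
noncomputable section

/-- The transcendence degree of `L` over `K`: the supremum of the cardinalities of
algebraically independent subsets of `L`. -/
noncomputable def trdeg (K L : Type*) [CommRing K] [CommRing L] [Algebra K L] : Cardinal :=
  ⨆ s : {s : Set L // AlgebraicIndependent K ((↑) : s → L)}, Cardinal.mk s.1

/-- The rational function field over `K` on variables indexed by `σ` :
the fraction field of the polynomial ring `K[x_i : i ∈ σ]`. -/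
abbrev FnField (K : Type*) [Field K] (σ : Type*) : Type _ :=
  FractionRing (MvPolynomial σ K)

/-- Permutations of the variables acting on the polynomial ring by `K`-algebra
automorphisms. -/
noncomputable def permHom (K : Type*) [Field K] (σ : Type*) :
    Equiv.Perm σ →* (MvPolynomial σ K ≃ₐ[K] MvPolynomial σ K) where
  toFun e := MvPolynomial.renameEquiv K e
  map_one' := MvPolynomial.renameEquiv_refl K
  map_mul' e f := by
    ext x
    simp [MvPolynomial.renameEquiv, Equiv.Perm.mul_apply]

/-- Permutations of the variables acting on the rational function field by
`K`-algebra automorphisms. -/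
noncomputable def permGalAction (K : Type*) [Field K] (σ : Type*) :
    Equiv.Perm σ →* (FnField K σ ≃ₐ[K] FnField K σ) :=
  (IsFractionRing.fieldEquivOfAlgEquivHom K (FnField K σ)).comp (permHom K σ)

/-- The action of a group `G` on its rational function field `K(x_g : g ∈ G)` by
`K`-algebra automorphisms, permuting the variables by left translation:
`σ • x_g = x_{σg}`. -/
noncomputable def galAction (K : Type*) [Field K] (G : Type*) [Group G] :
    G →* (FnField K G ≃ₐ[K] FnField K G) :=
  (permGalAction K G).comp (MulAction.toPermHom G G)

/-- The essential dimension of a group `G` over the field `K`: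
the minimum of the transcendence degrees over `K` of the `G`-stable intermediate
subfields of the rational function field `K(x_g : g ∈ G)` on which `G` acts
faithfully. -/
noncomputable def edK (K : Type*) [Field K] (G : Type*) [Group G] : ℕ :=
  sInf { d : ℕ | ∃ E : IntermediateField K (FnField K G),
    (∀ g : G, ∀ x ∈ E, galAction K G g x ∈ E) ∧
    (∀ g : G, g ≠ 1 → ∃ x ∈ E, galAction K G g x ≠ x) ∧
    trdeg K E = d }

section CrossRatio

variable {ι L M : Type*} [Field L] [Field M]

/-- The cross-ratio of the values of `y` at four indices. -/
def crossRatio (y : ι → L) (i j k l : ι) : L :=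
  (y i - y j) * (y k - y l) / ((y i - y l) * (y k - y j))

/-- The set of all cross-ratios of a family of field elements. -/
def crossRatioSet (y : ι → L) : Set L :=
  {x | ∃ i j k l, x = crossRatio y i j k l}

/-- The affine coordinate for which `y a`, `y b`, `y c` sit at `∞`, `0`, `1`. -/
def normCoord (y : ι → L) (a b c i : ι) : L :=
  ((y i - y a)⁻¹ - (y b - y a)⁻¹) / ((y c - y a)⁻¹ - (y b - y a)⁻¹)

lemma map_crossRatio {F : Type*} [FunLike F L M] [RingHomClass F L M] (f : F) (y : ι → L)
    (i j k l : ι) : f (crossRatio y i j k l) = crossRatio (fun t => f (y t)) i j k l := by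
  simp [crossRatio]

lemma crossRatio_eq_of_sub_eq {y : ι → L} {e : ι → ι → L} {r : ι → L} {d : L} (hd : d ≠ 0)
    (hr : ∀ i, r i ≠ 0) (h : ∀ i j, y i - y j = d * r i * r j * e i j) (i j k l : ι) :
    crossRatio y i j k l = e i j * e k l / (e i l * e k j) := by
  have hc : d ^ 2 * (r i * r j * r k * r l) ≠ 0 := by simp [hd, hr]
  rw [crossRatio, h, h, h, h, ← mul_div_mul_left (e i j * e k l) _ hc]
  congr 1 <;> ring

/-- All cross-ratios lie in the field generated by the normalised coordinates of the points
other than the three reference points. -/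
lemma crossRatioSet_subset {K : Type*} [Field K] [Algebra K L] {y : ι → L}
    (hy : Function.Injective y) {a b c : ι} (hbc : b ≠ c) :
    crossRatioSet y ⊆
      IntermediateField.adjoin K (normCoord y a b c '' ({a, b, c} : Set ι)ᶜ) := by
  classical
  set F := IntermediateField.adjoin K (normCoord y a b c '' ({a, b, c} : Set ι)ᶜ)
  have hs : ∀ i, i ≠ a → y i - y a ≠ 0 := fun i hi => sub_ne_zero.2 (hy.ne hi)
  set d : L := (y c - y a)⁻¹ - (y b - y a)⁻¹ with hd
  have hd0 : d ≠ 0 := by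
    rw [hd, sub_ne_zero, ne_eq, inv_inj, sub_left_inj]
    exact hy.ne hbc.symm
  have hz : ∀ i, i ≠ a → normCoord y a b c i ∈ F := by
    intro i hia
    by_cases hib : i = b
    · simp [normCoord, hib]
    by_cases hic : i = c
    · have : normCoord y a b c i = 1 := by rw [hic]; exact div_self hd0
      simp [this]
    · exact IntermediateField.subset_adjoin _ _ ⟨i, by simp [hia, hib, hic], rfl⟩
  let r : ι → L := fun i => if i = a then d⁻¹ else y i - y a
  let e : ι → ι → L := fun i j =>
    if i = a then (if j = a then 0 else -1)
    else if j = a then 1 else normCoord y a b c j - normCoord y a b c i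
  have hr : ∀ i, r i ≠ 0 := by
    intro i
    by_cases hi : i = a
    · simp [r, hi, hd0]
    · simpa [r, hi] using hs i hi
  have hyr : ∀ i j, y i - y j = d * r i * r j * e i j := by
    intro i j
    by_cases hi : i = a <;> by_cases hj : j = a
    · simp [e, hi, hj]
    · simp [e, r, hi, hj, hd0]
    · simp [e, r, hi, hj]
      field_simp
    · have h1 := hs i hi
      have h2 := hs j hj
      have : normCoord y a b c j - normCoord y a b c i
          = ((y j - y a)⁻¹ - (y i - y a)⁻¹) / d := by
        rw [normCoord, normCoord, ← hd]; ring
      simp only [e, r, hi, hj, if_false, this]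
      clear_value d
      field_simp
      ring
  have he : ∀ i j, e i j ∈ F := by
    intro i j
    by_cases hi : i = a <;> by_cases hj : j = a
    · simp [e, hi, hj]
    · simp [e, hi, hj]
    · simp [e, hi, hj]
    · simpa [e, hi, hj] using sub_mem (hz j hj) (hz i hi)
  rintro _ ⟨i, j, k, l, rfl⟩
  rw [crossRatio_eq_of_sub_eq hd0 hr hyr]
  exact div_mem (mul_mem (he _ _) (he _ _)) (mul_mem (he _ _) (he _ _))

end CrossRatio

open scoped IntermediateField.algebraAdjoinAdjoin in
lemma trdeg_adjoin_le {K L : Type*} [Field K] [Field L] [Algebra K L] (s : Set L) :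
    Algebra.trdeg K (IntermediateField.adjoin K s) ≤ Cardinal.mk s := by
  have h1 : Algebra.trdeg K (Algebra.adjoin K s) ≤ Cardinal.mk s := by
    have hrange : Algebra.adjoin K s = (MvPolynomial.aeval (R := K) ((↑) : s → L)).range := by
      rw [← Algebra.adjoin_range_eq_range_aeval, Subtype.range_coe]
    have h := lift_trdeg_le_of_surjective
      (MvPolynomial.aeval (R := K) ((↑) : s → L)).rangeRestrict
      (AlgHom.rangeRestrict_surjective _)
    rw [MvPolynomial.trdeg_of_isDomain, ← hrange] at h
    simpa using h
  have h2 := trdeg_add_eq K (Algebra.adjoin K s) (A := IntermediateField.adjoin K s)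
  rw [trdeg_eq_zero (R := Algebra.adjoin K s), add_zero] at h2
  exact h2 ▸ h1

lemma trdeg_adjoin_crossRatioSet_le {ι K L : Type*} [Fintype ι] [Field K] [Field L]
    [Algebra K L] {y : ι → L} (hy : Function.Injective y) (hι : 3 ≤ Fintype.card ι) :
    Algebra.trdeg K (IntermediateField.adjoin K (crossRatioSet y)) ≤
      (Fintype.card ι - 3 : ℕ) := by
  classical
  obtain ⟨a, b, c, hab, hac, hbc⟩ := Fintype.two_lt_card_iff.1 hι
  have hle : IntermediateField.adjoin K (crossRatioSet y) ≤
      IntermediateField.adjoin K (normCoord y a b c '' ({a, b, c} : Set ι)ᶜ) :=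
    IntermediateField.adjoin_le_iff.2 (crossRatioSet_subset hy hbc)
  refine (trdeg_le_of_injective (IntermediateField.inclusion hle)
    (IntermediateField.inclusion_injective hle)).trans ((trdeg_adjoin_le _).trans ?_)
  have hfin : (({a, b, c} : Finset ι)ᶜ).card = Fintype.card ι - 3 := by
    rw [Finset.card_compl, Finset.card_eq_three.2 ⟨a, b, c, hab, hac, hbc, rfl⟩]
  have himg : normCoord y a b c '' ({a, b, c} : Set ι)ᶜ
      = ((({a, b, c} : Finset ι)ᶜ).image (normCoord y a b c) : Finset L) := by
    simp only [Finset.coe_image, Finset.coe_compl, Finset.coe_insert, Finset.coe_singleton]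
  rw [himg, ← hfin]
  refine Cardinal.mk_coe_finset.le.trans ?_
  exact_mod_cast Finset.card_image_le

section SymmetricGroup

variable (K : Type*) [Field K] {ι : Type*} [Fintype ι] [DecidableEq ι]

/-- The sum of the variables `x_g` over all permutations `g` sending `o` to `i`. -/
def fiberSum (o i : ι) : MvPolynomial (Equiv.Perm ι) K :=
  ∑ g : Equiv.Perm ι with g o = i, MvPolynomial.X g

lemma rename_fiberSum (o i : ι) (g : Equiv.Perm ι) :
    MvPolynomial.rename (g * ·) (fiberSum K o i) = fiberSum K o (g i) := by
  rw [fiberSum, fiberSum, map_sum]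
  refine Finset.sum_equiv (Equiv.mulLeft g) (by simp) (by simp)

lemma galAction_fiberSum (o i : ι) (g : Equiv.Perm ι) :
    galAction K (Equiv.Perm ι) g (algebraMap _ _ (fiberSum K o i)) =
      algebraMap _ _ (fiberSum K o (g i)) := by
  rw [← rename_fiberSum]
  exact IsFractionRing.fieldEquivOfAlgEquiv_algebraMap K _ _ _ _

/-- The fibre sums may be specialised to arbitrary elements of a `K`-algebra. -/
lemma exists_algHom_fiberSum {R : Type*} [CommRing R] [Algebra K R] (o : ι) (f : ι → R) :
    ∃ φ : MvPolynomial (Equiv.Perm ι) K →ₐ[K] R, ∀ i, φ (fiberSum K o i) = f i := by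
  refine ⟨MvPolynomial.aeval fun g => if g = Equiv.swap o (g o) then f (g o) else 0,
    fun i => ?_⟩
  rw [fiberSum, map_sum, Finset.sum_eq_single (Equiv.swap o i)]
  · simp
  · intro g hg hne
    obtain rfl : g o = i := by simpa using hg
    simp [hne]
  · simp

lemma fiberSum_injective (o : ι) : Function.Injective (fiberSum K o) := by
  obtain ⟨φ, hφ⟩ := exists_algHom_fiberSum K o (MvPolynomial.X : ι → MvPolynomial ι K)
  intro i j h
  apply MvPolynomial.X_injective (R := K)
  rw [← hφ, ← hφ, h]

/-- The image of `fiberSum` in the rational function field. -/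
def fiberSumField (o i : ι) : FnField K (Equiv.Perm ι) :=
  algebraMap _ _ (fiberSum K o i)

lemma fiberSumField_injective (o : ι) : Function.Injective (fiberSumField K o) :=
  (IsFractionRing.injective (MvPolynomial (Equiv.Perm ι) K) _).comp (fiberSum_injective K o)

lemma galAction_crossRatio (o i j k l : ι) (g : Equiv.Perm ι) :
    galAction K (Equiv.Perm ι) g (crossRatio (fiberSumField K o) i j k l) =
      crossRatio (fiberSumField K o) (g i) (g j) (g k) (g l) := by
  rw [map_crossRatio]
  simp only [crossRatio, fiberSumField, galAction_fiberSum]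

/-- A cross-ratio of fibre sums involving the index `i'` differs from every one that does
not involve it. -/
lemma crossRatio_fiberSumField_ne (o : ι) {i j k l i' j' k' l' : ι}
    (hi : i ≠ i') (hj : j ≠ i') (hk : k ≠ i') (hl : l ≠ i')
    (hij : i ≠ j) (hil : i ≠ l) (hkl : k ≠ l) (hkj : k ≠ j)
    (hj' : j' ≠ i') (hk' : k' ≠ i') (hl' : l' ≠ i') (hjl' : j' ≠ l') (hkj' : k' ≠ j') :
    crossRatio (fiberSumField K o) i j k l ≠ crossRatio (fiberSumField K o) i' j' k' l' := by
  have hs : ∀ {s t : ι}, s ≠ t → fiberSumField K o s - fiberSumField K o t ≠ 0 := fun h =>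
    sub_ne_zero.2 ((fiberSumField_injective K o).ne h)
  intro h
  rw [crossRatio, crossRatio, div_eq_div_iff (mul_ne_zero (hs hil) (hs hkj))
    (mul_ne_zero (hs hl'.symm) (hs hkj'))] at h
  simp only [fiberSumField, ← map_sub, ← map_mul] at h
  have h := IsFractionRing.injective (MvPolynomial (Equiv.Perm ι) K) _ h
  obtain ⟨φ, hφ⟩ := exists_algHom_fiberSum K o
    fun t => (MvPolynomial.X (if t = i' then j' else t) : MvPolynomial ι K)
  have h := congrArg φ h
  have hX : ∀ {s t : ι}, s ≠ t → (MvPolynomial.X s - MvPolynomial.X t : MvPolynomial ι K) ≠ 0 :=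
    fun h => sub_ne_zero.2 (MvPolynomial.X_injective.ne h)
  simp only [map_mul, map_sub, hφ, hi, hj, hk, hl, hj', hk', hl', if_true, if_false, sub_self,
    zero_mul] at h
  exact mul_ne_zero (mul_ne_zero (hX hij) (hX hkl)) (mul_ne_zero (hX hjl') (hX hkj')) h

lemma exists_galAction_crossRatio_ne (hι : 5 ≤ Fintype.card ι) (o : ι) {g : Equiv.Perm ι}
    (hg : g ≠ 1) : ∃ x ∈ crossRatioSet (fiberSumField K o),
      galAction K (Equiv.Perm ι) g x ≠ x := by
  obtain ⟨i, hi⟩ : ∃ i, g i ≠ i := by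
    by_contra! h
    exact hg (Equiv.ext h)
  have hcard : 2 < (({i, g i} : Finset ι)ᶜ).card := by
    have := Finset.card_le_two (a := i) (b := g i)
    rw [Finset.card_compl]
    omega
  obtain ⟨j, k, l, hj, hk, hl, hjk, hjl, hkl⟩ := Finset.two_lt_card_iff.1 hcard
  simp only [Finset.mem_compl, Finset.mem_insert, Finset.mem_singleton, not_or] at hj hk hl
  refine ⟨_, ⟨i, j, k, l, rfl⟩, ?_⟩
  rw [galAction_crossRatio]
  exact (crossRatio_fiberSumField_ne K o hi.symm hj.2 hk.2 hl.2 (Ne.symm hj.1) (Ne.symm hl.1) hkl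
    hjk.symm (g.injective.ne hj.1) (g.injective.ne hk.1) (g.injective.ne hl.1) (g.injective.ne hjl)
    (g.injective.ne hjk.symm)).symm

end SymmetricGroup

/-- For any field `K` and any integer `n ≥ 5`, `ed_K(Sₙ) ≤ n - 3`. -/
theorem edK_symmGroup_le (K : Type*) [Field K] (n : ℕ) (hn : 5 ≤ n) :
    edK K (Equiv.Perm (Fin n)) ≤ n - 3 := by
  let o : Fin n := ⟨0, by omega⟩
  let E := IntermediateField.adjoin K (crossRatioSet (fiberSumField K o))
  have hE : trdeg K E ≤ (n - 3 : ℕ) := by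
    have := trdeg_adjoin_crossRatioSet_le (K := K) (fiberSumField_injective K o)
      (by simp; omega)
    rwa [Fintype.card_fin] at this
  obtain ⟨d, hd⟩ := Cardinal.lt_aleph0.1 (hE.trans_lt Cardinal.natCast_lt_aleph0)
  have hdn : d ≤ n - 3 := by exact_mod_cast hd ▸ hE
  refine le_trans (Nat.sInf_le (m := d) ⟨E, fun g x hx => ?_, fun g hg => ?_, hd⟩) hdn
  · have hle : E.map (galAction K (Equiv.Perm (Fin n)) g).toAlgHom ≤ E := by
      rw [IntermediateField.adjoin_map, IntermediateField.adjoin_le_iff]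
      rintro _ ⟨_, ⟨i, j, k, l, rfl⟩, rfl⟩
      exact IntermediateField.subset_adjoin _ _
        ⟨g i, g j, g k, g l, galAction_crossRatio K o i j k l g⟩
    exact hle ⟨x, hx, rfl⟩
  · obtain ⟨x, hx, hne⟩ := exists_galAction_crossRatio_ne K (by simpa using hn) o hg
    exact ⟨x, IntermediateField.subset_adjoin _ _ hx, hne⟩
end
end

section
/- Let p be a prime number and G a finite group. Let K be a field and assume the following four conditions: (i) char K = 0, or char K = l > 0 and G contains no non-trivial normal l-subgroup; (ii) there is an element σ in the center Z(G) of G with order exactly p; (iii) there is a group homomorphism (linear character) χ : G → K^× into the multiplicative group of K with χ(σ) ≠ 1; (iv) for every τ ∈ Z(G) of order m such that the cyclic subgroup ⟨σ⟩ is a proper subgroup of ⟨τ⟩, the field K does not contain a primitive m-th root of unity. Then ed_K(G) = ed_K(G/⟨σ⟩) + 1 (note that ⟨σ⟩ is a normal subgroup of G since σ is central). -/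
noncomputable section

open scoped IntermediateField.algebraAdjoinAdjoin

theorem galAction_algebraMap (K : Type*) [Field K] {G : Type*} [Group G] (g : G)
    (f : MvPolynomial G K) :
    galAction K G g (algebraMap _ (FnField K G) f) =
      algebraMap _ (FnField K G) (MvPolynomial.rename (g * ·) f) := by
  simp [galAction, permGalAction, permHom]
  rfl

theorem galAction_X (K : Type*) [Field K] {G : Type*} [Group G] (g h : G) :
    galAction K G g (algebraMap (MvPolynomial G K) (FnField K G) (MvPolynomial.X h)) =
      algebraMap (MvPolynomial G K) (FnField K G) (MvPolynomial.X (g * h)) := by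
  simp [galAction_algebraMap]

theorem trdeg_fnField_lt_aleph0 (K : Type*) [Field K] (G : Type*) [Finite G] :
    trdeg K (FnField K G) < Cardinal.aleph0 := by
  change Algebra.trdeg K (FnField K G) < Cardinal.aleph0
  have := (inferInstance : IsLocalization (nonZeroDivisors (MvPolynomial G K))
    (FnField K G)).isAlgebraic
  rw [← Cardinal.lift_lt_aleph0, ← lift_trdeg_add_eq K (MvPolynomial G K) (FnField K G),
    trdeg_eq_zero (R := MvPolynomial G K)]
  simp

theorem trdeg_intermediateField_lt_aleph0 {K : Type*} [Field K] {G : Type*} [Finite G]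
    (E : IntermediateField K (FnField K G)) : trdeg K E < Cardinal.aleph0 :=
  (trdeg_le_of_injective E.val E.val.injective).trans_lt (trdeg_fnField_lt_aleph0 K G)

theorem edK_le_trdeg {K : Type*} [Field K] {G : Type*} [Group G] [Finite G]
    (E : IntermediateField K (FnField K G))
    (hstable : ∀ g : G, ∀ x ∈ E, galAction K G g x ∈ E)
    (hfaithful : ∀ g : G, g ≠ 1 → ∃ x ∈ E, galAction K G g x ≠ x) :
    (edK K G : Cardinal) ≤ trdeg K E := by
  obtain ⟨n, hn⟩ := Cardinal.lt_aleph0.mp (trdeg_intermediateField_lt_aleph0 E)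
  rw [hn]
  exact Nat.cast_le.mpr (Nat.sInf_le ⟨E, hstable, hfaithful, hn⟩)

theorem exists_trdeg_eq_edK (K : Type*) [Field K] (G : Type*) [Group G] [Finite G] :
    ∃ E : IntermediateField K (FnField K G),
      (∀ g : G, ∀ x ∈ E, galAction K G g x ∈ E) ∧
      (∀ g : G, g ≠ 1 → ∃ x ∈ E, galAction K G g x ≠ x) ∧ trdeg K E = edK K G := by
  refine Nat.sInf_mem (s := { d : ℕ | ∃ E : IntermediateField K (FnField K G),
    (∀ g : G, ∀ x ∈ E, galAction K G g x ∈ E) ∧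
    (∀ g : G, g ≠ 1 → ∃ x ∈ E, galAction K G g x ≠ x) ∧ trdeg K E = d }) ?_
  obtain ⟨n, hn⟩ := Cardinal.lt_aleph0.mp (trdeg_intermediateField_lt_aleph0
    (⊤ : IntermediateField K (FnField K G)))
  refine ⟨n, ⊤, fun _ _ _ => IntermediateField.mem_top, fun g hg => ?_, hn⟩
  refine ⟨algebraMap (MvPolynomial G K) (FnField K G) (MvPolynomial.X 1),
    IntermediateField.mem_top, fun h => hg ?_⟩
  rw [galAction_X] at h
  simpa using MvPolynomial.X_injective (IsFractionRing.injective _ (FnField K G) h)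

theorem trdeg_adjoin_singleton_le {K L : Type*} [Field K] [Field L] [Algebra K L] (y : L) :
    trdeg K (IntermediateField.adjoin K {y}) ≤ 1 := by
  change Algebra.trdeg _ _ ≤ 1
  rw [← trdeg_add_eq K (Algebra.adjoin K {y}), trdeg_eq_zero (R := Algebra.adjoin K {y}), add_zero]
  let f : Polynomial K →ₐ[K] Algebra.adjoin K {y} :=
    (Polynomial.aeval y).codRestrict _ fun q => Polynomial.aeval_mem_adjoin_singleton K y
  have hf : Function.Surjective f := fun ⟨x, hx⟩ => by
    obtain ⟨q, rfl⟩ := by simpa [Algebra.adjoin_singleton_eq_range_aeval] using hx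
    exact ⟨q, rfl⟩
  rw [← Cardinal.lift_le]
  exact (lift_trdeg_le_of_surjective f hf).trans (by simp)

theorem trdeg_adjoin_insert_le {K L : Type*} [Field K] [Field L] [Algebra K L]
    (E : IntermediateField K L) (y : L) :
    trdeg K (IntermediateField.adjoin K (E ∪ {y} : Set L)) ≤ trdeg K E + 1 := by
  rw [← IntermediateField.restrictScalars_adjoin]
  change Algebra.trdeg K (IntermediateField.adjoin E {y}) ≤ Algebra.trdeg K E + 1
  have : FaithfulSMul E (IntermediateField.adjoin E {y}) :=
    (faithfulSMul_iff_algebraMap_injective _ _).mpr (algebraMap E _).injective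
  rw [← trdeg_add_eq K E]
  gcongr
  exact trdeg_adjoin_singleton_le y

/-- The polynomial ring homomorphism sending the variable of a coset to the sum of the
variables of its elements. -/
def cosetSumHom (K : Type*) [Field K] {G : Type*} [Group G] [Fintype G] (N : Subgroup G) :
    MvPolynomial (G ⧸ N) K →ₐ[K] MvPolynomial G K :=
  open Classical in
  MvPolynomial.aeval fun c => ∑ h : G, if (h : G ⧸ N) = c then MvPolynomial.X h else 0

theorem cosetSumHom_injective (K : Type*) [Field K] {G : Type*} [Group G] [Fintype G]
    (N : Subgroup G) : Function.Injective (cosetSumHom K N) := by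
  classical
  let r : MvPolynomial G K →ₐ[K] MvPolynomial (G ⧸ N) K :=
    MvPolynomial.aeval fun g =>
      if ((g : G ⧸ N).out = g) then MvPolynomial.X (g : G ⧸ N) else 0
  have h : r.comp (cosetSumHom K N) = AlgHom.id K _ := by
    ext1 c
    simp only [cosetSumHom, AlgHom.comp_apply, MvPolynomial.aeval_X, map_sum, AlgHom.id_apply]
    rw [Finset.sum_eq_single c.out]
    · simp [r]
    · intro b _ hb
      split_ifs with hc
      · subst hc
        simp [r, hb.symm]
      · simp
    · simp
  exact Function.LeftInverse.injective (g := r) fun x => DFunLike.congr_fun h x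

/-- The rational function field on the cosets embeds in the one on the group. -/
def cosetSumFieldHom (K : Type*) [Field K] {G : Type*} [Group G] [Fintype G]
    (N : Subgroup G) : FnField K (G ⧸ N) →ₐ[K] FnField K G :=
  IsFractionRing.liftAlgHom
    (g := (IsScalarTower.toAlgHom K (MvPolynomial G K) (FnField K G)).comp (cosetSumHom K N))
    ((IsFractionRing.injective (MvPolynomial G K) (FnField K G)).comp (cosetSumHom_injective K N))

theorem cosetSumFieldHom_algebraMap (K : Type*) [Field K] {G : Type*} [Group G] [Fintype G]
    (N : Subgroup G) (f : MvPolynomial (G ⧸ N) K) :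
    cosetSumFieldHom K N (algebraMap _ _ f) =
      algebraMap (MvPolynomial G K) (FnField K G) (cosetSumHom K N f) :=
  IsFractionRing.lift_algebraMap
    (g := ((IsScalarTower.toAlgHom K (MvPolynomial G K) (FnField K G)).comp
      (cosetSumHom K N)).toRingHom)
    ((IsFractionRing.injective (MvPolynomial G K) (FnField K G)).comp
      (cosetSumHom_injective K N) :) f

theorem cosetSumFieldHom_galAction (K : Type*) [Field K] {G : Type*} [Group G] [Fintype G]
    (N : Subgroup G) [N.Normal] (g : G) (z : FnField K (G ⧸ N)) :
    galAction K G g (cosetSumFieldHom K N z) =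
      cosetSumFieldHom K N (galAction K (G ⧸ N) g z) := by
  suffices h : ((galAction K G g).toAlgHom.comp (cosetSumFieldHom K N)).toRingHom =
      ((cosetSumFieldHom K N).comp (galAction K (G ⧸ N) g).toAlgHom).toRingHom from
    DFunLike.congr_fun h z
  refine IsLocalization.ringHom_ext (nonZeroDivisors (MvPolynomial (G ⧸ N) K)) ?_
  refine RingHom.ext fun f => ?_
  change galAction K G g (cosetSumFieldHom K N (algebraMap _ _ f)) =
    cosetSumFieldHom K N (galAction K (G ⧸ N) g (algebraMap _ _ f))
  rw [cosetSumFieldHom_algebraMap, galAction_algebraMap, galAction_algebraMap,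
    cosetSumFieldHom_algebraMap]
  congr 1
  change ((MvPolynomial.rename (g * ·)).comp (cosetSumHom K N)) f =
    ((cosetSumHom K N).comp (MvPolynomial.rename ((g : G ⧸ N) * ·))) f
  congr 1
  ext1 c
  simp only [cosetSumHom, AlgHom.comp_apply, MvPolynomial.aeval_X, map_sum,
    MvPolynomial.rename_X]
  refine Fintype.sum_equiv (Equiv.mulLeft g) _ _ fun h => ?_
  have hiff : (g : G ⧸ N) * h = g * c ↔ (h : G ⧸ N) = c := mul_right_inj _
  rw [Equiv.coe_mulLeft, QuotientGroup.mk_mul]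
  by_cases hc : (h : G ⧸ N) = c
  · rw [if_pos hc, if_pos (hiff.mpr hc), MvPolynomial.rename_X]
  · rw [if_neg hc, if_neg (hiff.not.mpr hc), map_zero]

/-- The `χ`-eigenvector `∑ χ(h)⁻¹ x_h`. -/
def charVector {K : Type*} [Field K] {G : Type*} [Group G] [Fintype G] (χ : G →* Kˣ) :
    MvPolynomial G K :=
  ∑ h : G, MvPolynomial.C ((χ h)⁻¹ : Kˣ).val * MvPolynomial.X h

theorem charVector_ne_zero {K : Type*} [Field K] {G : Type*} [Group G] [Fintype G]
    (χ : G →* Kˣ) : charVector χ ≠ 0 := by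
  classical
  intro h
  have := congrArg (MvPolynomial.aeval (fun g : G => if g = 1 then (1 : K) else 0)) h
  simp [charVector] at this

theorem galAction_charVector {K : Type*} [Field K] {G : Type*} [Group G] [Fintype G]
    (χ : G →* Kˣ) (g : G) :
    galAction K G g (algebraMap _ (FnField K G) (charVector χ)) =
      algebraMap K (FnField K G) (χ g) * algebraMap _ (FnField K G) (charVector χ) := by
  rw [galAction_algebraMap, IsScalarTower.algebraMap_apply K (MvPolynomial G K) (FnField K G),
    ← map_mul]
  congr 1
  simp only [charVector, map_sum, map_mul, MvPolynomial.rename_X, MvPolynomial.rename_C,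
    MvPolynomial.algebraMap_eq, Finset.mul_sum]
  refine Fintype.sum_equiv (Equiv.mulLeft g) _ _ fun h => ?_
  rw [← mul_assoc, ← map_mul, ← Units.val_mul]
  simp

theorem edK_le_edK_quotient_add_one {K : Type*} [Field K] {G : Type*} [Group G] [Finite G]
    (N : Subgroup G) [N.Normal] (χ : G →* Kˣ) (hχ : ∀ n ∈ N, χ n = 1 → n = 1) :
    edK K G ≤ edK K (G ⧸ N) + 1 := by
  have := Fintype.ofFinite G
  obtain ⟨E, hstable, hfaithful, hdeg⟩ := exists_trdeg_eq_edK K (G ⧸ N)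
  set ι := cosetSumFieldHom K N
  set y : FnField K G := algebraMap _ _ (charVector χ)
  have hy : y ≠ 0 := fun h => charVector_ne_zero χ <|
    IsFractionRing.injective (MvPolynomial G K) (FnField K G) (by rw [map_zero]; exact h)
  have hmap : (edK K (G ⧸ N) : Cardinal) = trdeg K (E.map ι) := by
    rw [← hdeg]
    exact AlgEquiv.trdeg_eq (E.equivMap ι)
  have hle := trdeg_adjoin_insert_le (E.map ι) y
  rw [← hmap] at hle
  have hsub := IntermediateField.subset_adjoin K ((E.map ι : Set (FnField K G)) ∪ {y})
  refine Nat.cast_le.mp ((edK_le_trdeg (IntermediateField.adjoin K _) ?_ ?_).trans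
    (hle.trans_eq (by simp)))
  · intro g
    change IntermediateField.adjoin K _ ≤
      (IntermediateField.adjoin K _).comap (galAction K G g).toAlgHom
    rw [IntermediateField.adjoin_le_iff]
    rintro _ (⟨z, hz, rfl⟩ | rfl)
    · refine hsub (Or.inl ⟨_, hstable g z hz, ?_⟩)
      exact (cosetSumFieldHom_galAction K N g z).symm
    · change galAction K G g y ∈ IntermediateField.adjoin K _
      rw [galAction_charVector]
      exact mul_mem (IntermediateField.algebraMap_mem _ _) (hsub (Or.inr rfl))
  · intro g hg
    by_cases hgN : g ∈ N
    · refine ⟨y, hsub (Or.inr rfl), fun h => hg (hχ g hgN ?_)⟩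
      rw [galAction_charVector, mul_eq_right₀ hy] at h
      exact Units.ext ((algebraMap K (FnField K G)).injective (by rw [h]; simp))
    · obtain ⟨z, hz, hne⟩ := hfaithful g (by rwa [Ne, QuotientGroup.eq_one_iff])
      refine ⟨ι z, hsub (Or.inl ⟨z, hz, rfl⟩), fun h => hne (ι.injective ?_)⟩
      exact (cosetSumFieldHom_galAction K N g z).symm.trans h

theorem trdeg_adjoin_subalgebra {K L : Type*} [Field K] [Field L] [Algebra K L]
    (S : Subalgebra K L) : trdeg K (IntermediateField.adjoin K (S : Set L)) = trdeg K S := by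
  change Algebra.trdeg _ _ = Algebra.trdeg _ _
  have := (inferInstance : IsLocalization (nonZeroDivisors (Algebra.adjoin K (S : Set L)))
    (IntermediateField.adjoin K (S : Set L))).isAlgebraic
  rw [← trdeg_add_eq K (Algebra.adjoin K (S : Set L)),
    trdeg_eq_zero (R := Algebra.adjoin K (S : Set L)), add_zero]
  exact AlgEquiv.trdeg_eq (Subalgebra.equivOfEq _ _ (Algebra.adjoin_eq S))

universe u v

theorem exists_specialization {K : Type u} [Field K] {G : Type v} [Group G] [Finite G]
    {M : Type (max u v)} [Field M] [Algebra K M] (α : G → M →ₐ[K] M)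
    (hα : ∀ f : MvPolynomial G K, f ≠ 0 → ∃ φ : MvPolynomial G K →ₐ[K] M,
      (∀ g q, φ (MvPolynomial.rename (g * ·) q) = α g (φ q)) ∧ φ f ≠ 0)
    (E : IntermediateField K (FnField K G))
    (hstable : ∀ g : G, ∀ x ∈ E, galAction K G g x ∈ E)
    (hfaithful : ∀ g : G, g ≠ 1 → ∃ x ∈ E, galAction K G g x ≠ x) :
    ∃ E' : IntermediateField K M, (∀ g, ∀ x ∈ E', α g x ∈ E') ∧
      (∀ g, g ≠ 1 → ∃ x ∈ E', α g x ≠ x) ∧ trdeg K E' ≤ trdeg K E := by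
  classical
  have := Fintype.ofFinite G
  have hinj := IsFractionRing.injective (MvPolynomial G K) (FnField K G)
  have hfrac : ∀ g : G, ∃ n d : MvPolynomial G K, d ≠ 0 ∧ (g ≠ 1 →
      algebraMap _ (FnField K G) n / algebraMap _ (FnField K G) d ∈ E ∧
      MvPolynomial.rename (g * ·) n * d - n * MvPolynomial.rename (g * ·) d ≠ 0) := by
    intro g
    by_cases hg : g = 1
    · exact ⟨0, 1, one_ne_zero, fun h => absurd hg h⟩
    obtain ⟨x, hx, hne⟩ := hfaithful g hg
    obtain ⟨n, d, hd, rfl⟩ := IsFractionRing.div_surjective (A := MvPolynomial G K) x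
    have hd0 := nonZeroDivisors.ne_zero hd
    refine ⟨n, d, hd0, fun _ => ⟨hx, fun h => hne ?_⟩⟩
    have hgd : MvPolynomial.rename (g * ·) d ≠ 0 := fun h0 => hd0 <|
      MvPolynomial.rename_injective _ (mul_right_injective g) (h0.trans (map_zero _).symm)
    rw [map_div₀, galAction_algebraMap, galAction_algebraMap, div_eq_div_iff
      (by simpa using hgd) (by simpa using hd0), ← map_mul, ← map_mul, sub_eq_zero.mp h]
  choose n d hd hnd using hfrac
  obtain ⟨φ, hφ, hφ0⟩ := hα (∏ g, d g * if g = 1 then 1 else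
      MvPolynomial.rename (g * ·) (n g) * d g - n g * MvPolynomial.rename (g * ·) (d g))
    (Finset.prod_ne_zero_iff.mpr fun g _ => mul_ne_zero (hd g) <| by
      split_ifs with h
      · exact one_ne_zero
      · exact (hnd g h).2)
  rw [map_prod, Finset.prod_ne_zero_iff] at hφ0
  let W : Submonoid (MvPolynomial G K) := (nonZeroDivisors M).comap φ
  have hW : ∀ w : W, φ w ≠ 0 := fun w => nonZeroDivisors.ne_zero w.2
  have hW0 : ∀ w : W, algebraMap (MvPolynomial G K) (FnField K G) w ≠ 0 := fun w h =>
    hW w <| by rw [hinj (h.trans (map_zero _).symm), map_zero]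
  let β : Localization W →ₐ[K] FnField K G :=
    IsLocalization.liftAlgHom (M := W)
      (f := IsScalarTower.toAlgHom K (MvPolynomial G K) (FnField K G))
      fun w => (hW0 w).isUnit
  let ψ : Localization W →ₐ[K] M :=
    IsLocalization.liftAlgHom (M := W) (f := φ) fun w => (hW w).isUnit
  have hβ0 : ∀ a, β (algebraMap _ _ a) = algebraMap _ (FnField K G) a :=
    fun a => IsLocalization.lift_eq (M := W) _ a
  have hβ : ∀ a (w : W), β (IsLocalization.mk' _ a w) =
      algebraMap _ (FnField K G) a / algebraMap _ (FnField K G) (w : MvPolynomial G K) := by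
    intro a w
    rw [eq_div_iff (hW0 w), ← hβ0, ← hβ0, ← map_mul, IsLocalization.mk'_spec]
  have hψ0 : ∀ a, ψ (algebraMap _ _ a) = φ a :=
    fun a => IsLocalization.lift_eq (M := W) _ a
  have hψ : ∀ a (w : W), ψ (IsLocalization.mk' _ a w) = φ a / φ w := by
    intro a w
    rw [eq_div_iff (hW w), ← hψ0, ← hψ0, ← map_mul, IsLocalization.mk'_spec]
  have hβinj : Function.Injective β := by
    rw [injective_iff_map_eq_zero]
    intro b hb
    obtain ⟨a, w, rfl⟩ := IsLocalization.exists_mk'_eq W b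
    rw [hβ, div_eq_zero_iff, or_iff_left (hW0 w)] at hb
    rw [hinj (hb.trans (map_zero _).symm), IsLocalization.mk'_zero]
  have hequiv : ∀ (g : G) (b : Localization W), ∃ b', β b' = galAction K G g (β b) ∧
      ψ b' = α g (ψ b) := by
    intro g b
    obtain ⟨a, w, rfl⟩ := IsLocalization.exists_mk'_eq W b
    have hgw : MvPolynomial.rename (g * ·) (w : MvPolynomial G K) ∈ W := by
      change φ _ ∈ nonZeroDivisors M
      rw [hφ]
      exact mem_nonZeroDivisors_of_ne_zero (by simpa using hW w)
    refine ⟨IsLocalization.mk' _ (MvPolynomial.rename (g * ·) a) ⟨_, hgw⟩, ?_, ?_⟩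
    · rw [hβ, hβ, map_div₀, galAction_algebraMap, galAction_algebraMap]
    · rw [hψ, hψ, map_div₀, hφ, hφ]
  let C : Subalgebra K (Localization W) := E.toSubalgebra.comap β
  refine ⟨IntermediateField.adjoin K (C.map ψ : Set M), fun g => ?_, fun g hg => ?_, ?_⟩
  · change IntermediateField.adjoin K _ ≤ (IntermediateField.adjoin K _).comap (α g)
    rw [IntermediateField.adjoin_le_iff]
    rintro _ ⟨b, hb, rfl⟩
    obtain ⟨b', h₁, h₂⟩ := hequiv g b
    refine IntermediateField.subset_adjoin K _ ⟨b', ?_, h₂⟩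
    change β b' ∈ E
    rw [h₁]
    exact hstable g _ hb
  · have hφg := hφ0 g (Finset.mem_univ _)
    rw [if_neg hg, map_mul, mul_ne_zero_iff] at hφg
    let w : W := ⟨d g, mem_nonZeroDivisors_of_ne_zero hφg.1⟩
    refine ⟨ψ (IsLocalization.mk' _ (n g) w), IntermediateField.subset_adjoin K _ ⟨_, ?_, rfl⟩,
      fun h => hφg.2 ?_⟩
    · change β _ ∈ E
      rw [hβ]
      exact (hnd g hg).1
    · rw [hψ, map_div₀, ← hφ, ← hφ, div_eq_div_iff (by rw [hφ]; simpa using hφg.1) hφg.1] at h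
      rw [map_sub, map_mul, map_mul, h, sub_self]
  · rw [trdeg_adjoin_subalgebra]
    refine (trdeg_le_of_surjective (A := C) (ψ.subalgebraMap C) ?_).trans
      (trdeg_le_of_injective (A' := E) ((β.comp C.val).codRestrict E.toSubalgebra fun b => b.2) ?_)
    · rintro ⟨_, b, hb, rfl⟩
      exact ⟨⟨b, hb⟩, rfl⟩
    · intro x y hxy
      exact Subtype.ext (hβinj (congrArg Subtype.val hxy))
theorem exists_aeval_X_pow_ne_zero {K : Type*} [Field K] {ι : Type*} [Finite ι] (p : ℕ)
    {f : MvPolynomial (ι × Fin p) K} (hf : f ≠ 0) :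
    ∃ N : ℕ, MvPolynomial.aeval
      (fun c : ι × Fin p => (MvPolynomial.X c.1 ^ N ^ (c.2 : ℕ) : MvPolynomial ι K)) f ≠ 0 := by
  classical
  have := Fintype.ofFinite ι
  set N := f.totalDegree + 1
  let D : (ι × Fin p →₀ ℕ) → ι →₀ ℕ := fun d =>
    ∑ c : ι × Fin p, Finsupp.single c.1 (N ^ (c.2 : ℕ) * d c)
  have hmon : ∀ d, MvPolynomial.aeval
      (fun c : ι × Fin p => (MvPolynomial.X c.1 ^ N ^ (c.2 : ℕ) : MvPolynomial ι K))
      (MvPolynomial.monomial d (f.coeff d)) = MvPolynomial.monomial (D d) (f.coeff d) := by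
    intro d
    rw [MvPolynomial.aeval_monomial, MvPolynomial.algebraMap_eq, ← mul_one (f.coeff d),
      ← MvPolynomial.C_mul_monomial, mul_one, MvPolynomial.monomial_sum_one,
      Finsupp.prod_fintype _ _ fun _ => pow_zero _]
    refine congrArg _ (Finset.prod_congr rfl fun c _ => ?_)
    rw [← pow_mul, MvPolynomial.X_pow_eq_monomial]
  have hD : ∀ d c, D d c = ∑ i : Fin p, d (c, i) * N ^ (i : ℕ) := by
    intro d c
    simp only [D, Finsupp.finsetSum_apply, Finsupp.single_apply, Fintype.sum_prod_type]
    rw [Finset.sum_eq_single c]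
    · simp [mul_comm]
    · intro b _ hb
      simp [hb]
    · simp
  have hlt : ∀ d ∈ f.support, ∀ c, d c < N := fun d hd c =>
    Nat.lt_succ_of_le <| (Finsupp.le_degree c d).trans <| MvPolynomial.le_totalDegree hd
  have hinj : Set.InjOn D f.support := by
    intro d hd d' hd' h
    ext ⟨c, i⟩
    have := finFunctionFinEquiv.injective (a₁ := fun i => (⟨d (c, i), hlt d hd _⟩ : Fin N))
      (a₂ := fun i => ⟨d' (c, i), hlt d' hd' _⟩) (Fin.ext (by
        simp only [finFunctionFinEquiv_apply, ← hD, h]))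
    exact congrArg Fin.val (congrFun this i)
  obtain ⟨d, hd⟩ := Finset.nonempty_of_ne_empty (mt MvPolynomial.support_eq_empty.mp hf)
  refine ⟨N, fun h => MvPolynomial.mem_support_iff.mp hd ?_⟩
  have h := congrArg (MvPolynomial.coeff (D d)) h
  rw [f.as_sum, map_sum, Finset.sum_congr rfl fun d _ => hmon d, MvPolynomial.coeff_sum,
    Finset.sum_eq_single d] at h
  · simpa using h
  · intro d' hd' hne
    rw [MvPolynomial.coeff_monomial, if_neg fun h => hne (hinj hd' hd h)]
  · exact fun h => absurd hd h

/-- A partial Fourier transform along the subgroup `N`, with respect to the character `χ`. -/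
def fourierHom {K : Type*} [Field K] {G : Type*} [Group G] (N : Subgroup G)
    (χ : G →* Kˣ) (p : ℕ) : MvPolynomial G K →ₐ[K] MvPolynomial ((G ⧸ N) × Fin p) K :=
  MvPolynomial.aeval fun g =>
    ∑ i : Fin p, MvPolynomial.C ((χ g : K) ^ (i : ℕ)) * MvPolynomial.X ((g : G ⧸ N), i)

theorem fourierHom_injective {K : Type*} [Field K] {G : Type*} [Group G] [Finite G]
    (N : Subgroup G) (χ : G →* Kˣ) (hχ : ∀ n ∈ N, χ n = 1 → n = 1) (p : ℕ)
    (hp : ∀ n ∈ N, n ^ p = 1) (hpK : (p : K) ≠ 0) :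
    Function.Injective (fourierHom N χ p) := by
  classical
  have := Fintype.ofFinite G
  let r : MvPolynomial ((G ⧸ N) × Fin p) K →ₐ[K] MvPolynomial G K :=
    MvPolynomial.aeval fun c => ∑ h : G, if (h : G ⧸ N) = c.1 then
      MvPolynomial.C ((p : K)⁻¹ * (χ h : K)⁻¹ ^ (c.2 : ℕ)) * MvPolynomial.X h else 0
  have h : r.comp (fourierHom N χ p) = AlgHom.id K _ := by
    ext1 g
    simp only [fourierHom, AlgHom.comp_apply, MvPolynomial.aeval_X, map_sum, map_mul,
      AlgHom.id_apply, MvPolynomial.algHom_C, r, MvPolynomial.algebraMap_eq, Finset.mul_sum]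
    rw [Finset.sum_comm, Finset.sum_eq_single g]
    · simp only [if_true, ← mul_assoc, ← map_mul, ← Finset.sum_mul, ← map_sum]
      rw [Finset.sum_congr rfl (g := fun _ => (p : K)⁻¹)]
      · simp [hpK]
      · intro i _
        rw [mul_right_comm, ← mul_pow, mul_inv_cancel₀ (Units.ne_zero _), one_pow, one_mul]
    · intro h _ hne
      split_ifs with hc
      · simp only [← mul_assoc, ← map_mul, ← Finset.sum_mul, ← map_sum]
        convert zero_mul _
        rw [← map_zero MvPolynomial.C]
        congr 1
        have hmem : h⁻¹ * g ∈ N := QuotientGroup.eq.mp hc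
        set z : K := (χ g : K) * (χ h : K)⁻¹
        have hz : z = (χ (h⁻¹ * g) : Kˣ) := by simp [z, mul_comm]
        have hz1 : z ≠ 1 := fun h1 => hne (inv_mul_eq_one.mp
          (hχ _ hmem (Units.ext (hz.symm.trans h1))))
        have hzp : z ^ p = 1 := by
          rw [hz, ← Units.val_pow_eq_pow_val, ← map_pow, hp _ hmem, map_one, Units.val_one]
        have hgeom : ∑ i : Fin p, z ^ (i : ℕ) = 0 := by
          rw [Fin.sum_univ_eq_sum_range (fun i => z ^ i)]
          exact (mul_eq_zero_iff_right (sub_ne_zero.mpr hz1)).mp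
            (by rw [geom_sum_mul, hzp, sub_self])
        rw [← mul_zero (p : K)⁻¹, ← hgeom, Finset.mul_sum]
        refine Finset.sum_congr rfl fun i _ => ?_
        rw [mul_pow]
        ring
      · simp
    · simp
  exact Function.LeftInverse.injective (g := r) fun x => DFunLike.congr_fun h x

theorem algebraMap_hahnSeries {K F : Type*} [Field K] [Field F] [Algebra K F] (r : K) :
    algebraMap K (HahnSeries ℤ F) r = HahnSeries.single 0 (algebraMap K F r) := by
  rw [HahnSeries.algebraMap_apply', PowerSeries.algebraMap_apply, HahnSeries.ofPowerSeries_C,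
    HahnSeries.C_apply]

/-- The action of `G` on Laurent series that combines an action on the coefficients with
multiplication of the uniformizer by the character `χ`. -/
def twistHom {K F G : Type*} [Field K] [Field F] [Algebra K F] [Group G]
    (β : G →* (F ≃ₐ[K] F)) (χ : G →* Kˣ) (g : G) : HahnSeries ℤ F →ₐ[K] HahnSeries ℤ F where
  toFun x := ⟨fun n => algebraMap K F (χ g ^ n : Kˣ) * β g (x.coeff n),
    x.isPWO_support.mono fun n hn h => hn (by simp [h])⟩
  map_one' := by
    ext n
    by_cases h : n = 0 <;> simp [HahnSeries.coeff_one, h]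
  map_zero' := by
    ext n
    simp
  map_add' x y := by
    ext n
    simp [mul_add]
  map_mul' x y := by
    ext n
    change algebraMap K F (χ g ^ n : Kˣ) * β g ((x * y).coeff n) = _
    rw [HahnSeries.coeff_mul, HahnSeries.coeff_mul, map_sum, Finset.mul_sum]
    refine Finset.sum_congr ?_ fun ij hij => ?_
    · have hc : ∀ n : ℤ, algebraMap K F (χ g ^ n : Kˣ) ≠ 0 := fun n =>
        (map_ne_zero _).mpr (Units.ne_zero _)
      ext ij
      simp only [Finset.mem_antidiagonal, HahnSeries.mem_support, ne_eq, mul_eq_zero, hc,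
        false_or, map_eq_zero]
    · rw [← (Finset.mem_antidiagonal.mp hij).2.2]
      simp only [zpow_add, Units.val_mul, map_mul]
      ring
  commutes' r := by
    ext n
    rw [algebraMap_hahnSeries]
    by_cases h : n = 0 <;> simp [h]

theorem twistHom_coeff {K F G : Type*} [Field K] [Field F] [Algebra K F] [Group G]
    (β : G →* (F ≃ₐ[K] F)) (χ : G →* Kˣ) (g : G) (x : HahnSeries ℤ F) (n : ℤ) :
    (twistHom β χ g x).coeff n = algebraMap K F (χ g ^ n : Kˣ) * β g (x.coeff n) := rfl

theorem twistHom_one {K F G : Type*} [Field K] [Field F] [Algebra K F] [Group G]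
    (β : G →* (F ≃ₐ[K] F)) (χ : G →* Kˣ) (x : HahnSeries ℤ F) : twistHom β χ 1 x = x := by
  ext n
  simp [twistHom_coeff]

theorem twistHom_mul {K F G : Type*} [Field K] [Field F] [Algebra K F] [Group G]
    (β : G →* (F ≃ₐ[K] F)) (χ : G →* Kˣ) (g h : G) (x : HahnSeries ℤ F) :
    twistHom β χ (g * h) x = twistHom β χ g (twistHom β χ h x) := by
  ext n
  simp [twistHom_coeff, mul_zpow, mul_assoc]

theorem twistHom_order {K F G : Type*} [Field K] [Field F] [Algebra K F] [Group G]
    (β : G →* (F ≃ₐ[K] F)) (χ : G →* Kˣ) (g : G) (x : HahnSeries ℤ F) :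
    (twistHom β χ g x).order = x.order := by
  by_cases hx : x = 0
  · simp [hx]
  refine le_antisymm (HahnSeries.order_le_of_coeff_ne_zero ?_) (HahnSeries.order_le_of_coeff_ne_zero
    fun h => ?_)
  · rw [twistHom_coeff, mul_ne_zero_iff, map_ne_zero, map_ne_zero]
    exact ⟨Units.ne_zero _, HahnSeries.coeff_order_eq_zero.not.mpr hx⟩
  · refine HahnSeries.coeff_order_eq_zero.not.mpr ((map_ne_zero (twistHom β χ g)).mpr hx) ?_
    rw [twistHom_coeff, h, map_zero, mul_zero]

theorem twistHom_leadingCoeff {K F G : Type*} [Field K] [Field F] [Algebra K F] [Group G]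
    (β : G →* (F ≃ₐ[K] F)) (χ : G →* Kˣ) (g : G) (x : HahnSeries ℤ F) :
    (twistHom β χ g x).leadingCoeff =
      algebraMap K F (χ g ^ x.order : Kˣ) * β g x.leadingCoeff := by
  rw [HahnSeries.leadingCoeff_eq, HahnSeries.leadingCoeff_eq, twistHom_order, twistHom_coeff]

universe w

theorem trdeg_add_one_le_of_surjective {K : Type*} {A B : Type w} [Field K] [CommRing A]
    [IsDomain A] [Algebra K A] [CommRing B] [IsDomain B] [Algebra K B] (π : A →ₐ[K] B)
    (hπ : Function.Surjective π) {t : A} (ht : t ≠ 0) (hπt : π t = 0) :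
    trdeg K B + 1 ≤ trdeg K A := by
  change Algebra.trdeg K B + 1 ≤ Algebra.trdeg K A
  have : FaithfulSMul K B :=
    (faithfulSMul_iff_algebraMap_injective _ _).mpr (algebraMap K B).injective
  obtain ⟨ι, b, hb⟩ := exists_isTranscendenceBasis' K B
  choose f hf using fun i => hπ (b i)
  have hind : AlgebraicIndependent K f := .of_comp π ((funext hf : π ∘ f = b) ▸ hb.1)
  rw [← hb.cardinalMk_eq_trdeg, ← Cardinal.mk_option]
  refine AlgebraicIndependent.cardinalMk_le_trdeg (x := fun o : Option ι => o.elim t f)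
    ((AlgebraicIndependent.option_iff_transcendental hind t).mpr fun ⟨P, hP, hPt⟩ => ?_)
  obtain ⟨Q, hPQ, hQ⟩ := P.exists_eq_pow_rootMultiplicity_mul_and_not_dvd hP 0
  rw [map_zero, sub_zero] at hPQ hQ
  rw [Polynomial.X_dvd_iff] at hQ
  rw [hPQ, map_mul, map_pow, Polynomial.aeval_X, mul_eq_zero,
    or_iff_right (pow_ne_zero _ ht)] at hPt
  have hQ0 : π (Q.coeff 0 : A) = 0 := by
    have h := congrArg π hPt
    rw [← Q.divX_mul_X_add, map_add, map_mul, Polynomial.aeval_X, Polynomial.aeval_C, map_add,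
      map_mul, hπt, mul_zero, zero_add, map_zero] at h
    exact h
  obtain ⟨q, hq⟩ : ∃ q, MvPolynomial.aeval f q = (Q.coeff 0 : A) :=
    (Algebra.adjoin_range_eq_range_aeval K f).le (Q.coeff 0).2
  rw [← hq, ← AlgHom.comp_apply, MvPolynomial.comp_aeval, funext hf] at hQ0
  refine hQ (Subtype.ext ?_)
  rw [← hq, (injective_iff_map_eq_zero _).mp hb.1 q hQ0, map_zero]
  rfl

theorem exists_ofPowerSeries_eq {F : Type*} [Field F] {x : HahnSeries ℤ F}
    (hx : ∀ n < 0, x.coeff n = 0) : ∃ f, HahnSeries.ofPowerSeries ℤ F f = x := by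
  refine ⟨PowerSeries.mk fun n => x.coeff n, ?_⟩
  ext n
  obtain hn | hn := lt_or_ge n 0
  · rw [hx n hn, HahnSeries.ofPowerSeries_apply, HahnSeries.embDomain_of_notMem_range]
    rintro ⟨k, rfl⟩
    exact absurd hn (by simp)
  · lift n to ℕ using hn
    exact (HahnSeries.ofPowerSeries_apply_coeff _ n).trans (PowerSeries.coeff_mk _ _)

theorem ofPowerSeries_coeff_of_neg {F : Type*} [Field F] (f : PowerSeries F) {n : ℤ}
    (hn : n < 0) : (HahnSeries.ofPowerSeries ℤ F f).coeff n = 0 := by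
  rw [HahnSeries.ofPowerSeries_apply, HahnSeries.embDomain_of_notMem_range]
  rintro ⟨k, rfl⟩
  exact absurd hn (by simp)

theorem ofPowerSeries_coeff_zero {F : Type*} [Field F] (f : PowerSeries F) :
    (HahnSeries.ofPowerSeries ℤ F f).coeff 0 = PowerSeries.constantCoeff f := by
  simpa using HahnSeries.ofPowerSeries_apply_coeff (Γ := ℤ) f 0

/-- The inclusion of power series into Laurent series, as an algebra homomorphism. -/
def ofPowerSeriesHom (K F : Type*) [Field K] [Field F] [Algebra K F] :
    PowerSeries F →ₐ[K] HahnSeries ℤ F :=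
  { HahnSeries.ofPowerSeries ℤ F with commutes' := fun _ => rfl }

/-- The ring of power series contained in a field of Laurent series. -/
def integerSubalgebra {K F : Type*} [Field K] [Field F] [Algebra K F]
    (E : IntermediateField K (HahnSeries ℤ F)) : Subalgebra K (PowerSeries F) :=
  E.toSubalgebra.comap (ofPowerSeriesHom K F)

/-- The residue field of a field of Laurent series. -/
def residueSubfield {K F : Type*} [Field K] [Field F] [Algebra K F]
    (E : IntermediateField K (HahnSeries ℤ F)) : IntermediateField K F where
  toSubalgebra := (integerSubalgebra E).map
    { PowerSeries.constantCoeff (R := F) with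
      commutes' := fun r => by simp [PowerSeries.algebraMap_apply] }
  inv_mem' := by
    rintro _ ⟨f, hf, rfl⟩
    by_cases h : PowerSeries.constantCoeff f = 0
    · exact ⟨0, zero_mem _, by simpa using h.symm⟩
    refine ⟨f⁻¹, ?_, by simp⟩
    have h1 : HahnSeries.ofPowerSeries ℤ F f⁻¹ = (HahnSeries.ofPowerSeries ℤ F f)⁻¹ :=
      eq_inv_of_mul_eq_one_left (by rw [← map_mul, PowerSeries.inv_mul_cancel f h, map_one])
    change HahnSeries.ofPowerSeries ℤ F f⁻¹ ∈ E
    rw [h1]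
    exact inv_mem hf

theorem mem_residueSubfield {K F : Type*} [Field K] [Field F] [Algebra K F]
    {E : IntermediateField K (HahnSeries ℤ F)} {a : F} :
    a ∈ residueSubfield E ↔ ∃ x ∈ E, (∀ n < 0, x.coeff n = 0) ∧ x.coeff 0 = a := by
  constructor
  · rintro ⟨f, hf, rfl⟩
    exact ⟨_, hf, fun n hn => ofPowerSeries_coeff_of_neg f hn, ofPowerSeries_coeff_zero f⟩
  · rintro ⟨x, hx, hn, rfl⟩
    obtain ⟨f, rfl⟩ := exists_ofPowerSeries_eq hn
    exact ⟨f, hx, (ofPowerSeries_coeff_zero f).symm⟩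

theorem leadingCoeff_mem_residueSubfield {K F : Type*} [Field K] [Field F] [Algebra K F]
    {E : IntermediateField K (HahnSeries ℤ F)} {x : HahnSeries ℤ F} (hx : x ∈ E)
    (h : x.order = 0) : x.leadingCoeff ∈ residueSubfield E :=
  mem_residueSubfield.mpr ⟨x, hx, fun _ hn => HahnSeries.coeff_eq_zero_of_lt_order (h ▸ hn),
    by rw [HahnSeries.leadingCoeff_eq, h]⟩

theorem trdeg_residueSubfield_add_one_le {K : Type*} {F : Type w} [Field K] [Field F]
    [Algebra K F] (E : IntermediateField K (HahnSeries ℤ F)) {t : HahnSeries ℤ F} (ht : t ∈ E)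
    (ht0 : t.order ≠ 0) : trdeg K (residueSubfield E) + 1 ≤ trdeg K E := by
  wlog hpos : 0 < t.order generalizing t
  · have hne : t ≠ 0 := fun h => ht0 (by simp [h])
    have h := HahnSeries.order_mul hne (inv_ne_zero hne)
    rw [mul_inv_cancel₀ hne, HahnSeries.order_one] at h
    exact this (inv_mem ht) (by omega) (by omega)
  obtain ⟨T, rfl⟩ := exists_ofPowerSeries_eq (x := t) fun n hn =>
    HahnSeries.coeff_eq_zero_of_lt_order (hn.trans hpos)
  refine (trdeg_add_one_le_of_surjective (A := integerSubalgebra E) (t := ⟨T, ht⟩)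
    (AlgHom.subalgebraMap _ _) ?_ ?_ ?_).trans (trdeg_le_of_injective
    (A' := E) (((ofPowerSeriesHom K F).comp (integerSubalgebra E).val).codRestrict
      E.toSubalgebra fun f => f.2) ?_)
  · rintro ⟨_, f, hf, rfl⟩
    exact ⟨⟨f, hf⟩, rfl⟩
  · rintro h
    obtain rfl := congrArg Subtype.val h
    simp at hpos
  · refine Subtype.ext ?_
    change PowerSeries.constantCoeff T = 0
    rw [← ofPowerSeries_coeff_zero]
    exact HahnSeries.coeff_eq_zero_of_lt_order hpos
  · intro f g hfg
    exact Subtype.ext (HahnSeries.ofPowerSeries_injective (congrArg Subtype.val hfg))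

theorem residueSubfield_stable {K F G : Type*} [Field K] [Field F] [Algebra K F] [Group G]
    (β : G →* (F ≃ₐ[K] F)) (χ : G →* Kˣ) {E : IntermediateField K (HahnSeries ℤ F)} {g : G}
    (hE : ∀ x ∈ E, twistHom β χ g x ∈ E) {a : F} (ha : a ∈ residueSubfield E) :
    β g a ∈ residueSubfield E := by
  obtain ⟨x, hx, hn, rfl⟩ := mem_residueSubfield.mp ha
  refine mem_residueSubfield.mpr ⟨_, hE x hx, fun n h => ?_, ?_⟩
  · rw [twistHom_coeff, hn n h, map_zero, mul_zero]
  · simp [twistHom_coeff]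

section Inertia

variable {K F G : Type*} [Field K] [Field F] [Algebra K F] [Group G]
  (β : G →* (F ≃ₐ[K] F)) (χ : G →* Kˣ) (E : IntermediateField K (HahnSeries ℤ F))

/-- The wild inertia group: the elements acting trivially on leading coefficients. -/
def wildInertia (hE : ∀ g, ∀ x ∈ E, twistHom β χ g x ∈ E) : Subgroup G where
  carrier := {n | ∀ x ∈ E, (twistHom β χ n x).leadingCoeff = x.leadingCoeff}
  one_mem' x _ := by rw [twistHom_one]
  mul_mem' {n m} hn hm x hx := by rw [twistHom_mul, hn _ (hE m x hx), hm x hx]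
  inv_mem' {n} hn x hx := by
    rw [← hn _ (hE n⁻¹ x hx), ← twistHom_mul, mul_inv_cancel, twistHom_one]

/-- The inertia group: the elements acting trivially on the residue field. -/
def inertia : Subgroup G where
  carrier := {n | ∀ a ∈ residueSubfield E, β n a = a}
  one_mem' a _ := by simp
  mul_mem' {n m} hn hm a ha := by rw [map_mul, AlgEquiv.mul_apply, hm a ha, hn a ha]
  inv_mem' {n} hn a ha := by
    rw [map_inv]
    exact (AlgEquiv.symm_apply_eq (β n)).mpr (hn a ha).symm

variable {β χ E}

theorem wildInertia_normal (hE : ∀ g, ∀ x ∈ E, twistHom β χ g x ∈ E) :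
    (wildInertia β χ E hE).Normal where
  conj_mem n hn g x hx := by
    rw [mul_assoc, twistHom_mul, twistHom_leadingCoeff, twistHom_mul, hn _ (hE g⁻¹ x hx),
      twistHom_order, ← twistHom_leadingCoeff, ← twistHom_mul, mul_inv_cancel, twistHom_one]

theorem inertia_normal (hE : ∀ g, ∀ x ∈ E, twistHom β χ g x ∈ E) : (inertia β E).Normal where
  conj_mem n hn g a ha := by
    rw [map_mul, map_mul, AlgEquiv.mul_apply, AlgEquiv.mul_apply,
      hn _ (residueSubfield_stable β χ (hE g⁻¹) ha), ← AlgEquiv.mul_apply, ← map_mul,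
      mul_inv_cancel, map_one, AlgEquiv.one_apply]

theorem eq_one_of_mem_wildInertia (hE : ∀ g, ∀ x ∈ E, twistHom β χ g x ∈ E)
    (hfaithful : ∀ g, g ≠ 1 → ∃ x ∈ E, twistHom β χ g x ≠ x) {n : G}
    (hn : n ∈ wildInertia β χ E hE) {q : ℕ} (hq : (q : K) ≠ 0) (hnq : n ^ q = 1) : n = 1 := by
  by_contra hn1
  obtain ⟨x, hx, hne⟩ := hfaithful n hn1
  set d := twistHom β χ n x - x
  have hd : d ≠ 0 := sub_ne_zero.mpr hne
  have hdE : d ∈ E := sub_mem (hE n x hx) hx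
  have hsum : ∑ j ∈ Finset.range q, twistHom β χ (n ^ j) d = 0 := by
    simp only [d, map_sub, ← twistHom_mul, ← pow_succ]
    rw [Finset.sum_range_sub fun j => twistHom β χ (n ^ j) x, hnq, pow_zero, sub_self]
  have hcoeff : ∀ j, (twistHom β χ (n ^ j) d).coeff d.order = d.leadingCoeff := fun j => by
    rw [← pow_mem hn j d hdE, HahnSeries.leadingCoeff_eq, twistHom_order]
  have h := congrArg (fun y => HahnSeries.coeff y d.order) hsum
  simp only [HahnSeries.coeff_sum, hcoeff, Finset.sum_const, Finset.card_range, nsmul_eq_mul,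
    HahnSeries.coeff_zero, mul_eq_zero, HahnSeries.leadingCoeff_eq_zero, hd, or_false] at h
  exact hq ((algebraMap K F).injective (by simpa using h))

theorem wildInertia_eq_bot [Finite G]
    (hchar : ringChar K = 0 ∨ (ringChar K ≠ 0 ∧
      ∀ H : Subgroup G, H.Normal → IsPGroup (ringChar K) H → H = ⊥))
    (hE : ∀ g, ∀ x ∈ E, twistHom β χ g x ∈ E)
    (hfaithful : ∀ g, g ≠ 1 → ∃ x ∈ E, twistHom β χ g x ≠ x) :
    wildInertia β χ E hE = ⊥ := by
  obtain h0 | ⟨h0, hH⟩ := hchar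
  · refine (Subgroup.eq_bot_iff_forall _).mpr fun n hn =>
      eq_one_of_mem_wildInertia hE hfaithful hn (fun h => ?_) (pow_orderOf_eq_one n)
    rw [ringChar.spec, h0, zero_dvd_iff] at h
    exact (orderOf_pos n).ne' h
  · refine hH _ (wildInertia_normal hE) fun ⟨n, hn⟩ => ?_
    have hl : ringChar K ≠ 1 := fun h => one_ne_zero (α := K) (by
      simpa using (ringChar.spec K 1).mpr h.dvd)
    obtain ⟨k, m, hm, hkm⟩ :=
      Nat.exists_eq_pow_mul_and_not_dvd (orderOf_pos n).ne' (ringChar K) hl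
    refine ⟨k, Subtype.ext ?_⟩
    refine eq_one_of_mem_wildInertia hE hfaithful (pow_mem hn _) (q := m)
      (mt (ringChar.spec K m).mp hm) ?_
    change (n ^ ringChar K ^ k) ^ m = 1
    rw [← pow_mul, ← hkm, pow_orderOf_eq_one]

/-- The order of the non-zero elements of a field of Laurent series. -/
def unitOrderHom (E : IntermediateField K (HahnSeries ℤ F)) : Eˣ →* Multiplicative ℤ where
  toFun x := Multiplicative.ofAdd (x : HahnSeries ℤ F).order
  map_one' := by simp
  map_mul' x y := by
    rw [← ofAdd_add, ← HahnSeries.order_mul (by simp) (by simp)]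
    rfl

variable (β χ E) in
/-- The effect of `g` on the leading coefficients of Laurent series in `E`. -/
def leadingCoeffRatio (g : G) : Eˣ →* F where
  toFun x := (twistHom β χ g x).leadingCoeff / (x : HahnSeries ℤ F).leadingCoeff
  map_one' := by simp
  map_mul' x y := by
    simp [HahnSeries.leadingCoeff_mul, mul_div_mul_comm]

theorem leadingCoeffRatio_mul_leadingCoeff (g : G) (x : Eˣ) :
    leadingCoeffRatio β χ E g x * (x : HahnSeries ℤ F).leadingCoeff =
      (twistHom β χ g x).leadingCoeff :=
  div_mul_cancel₀ _ (by simp)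

theorem leadingCoeffRatio_congr {n : G} (hn : n ∈ inertia β E) {x y : Eˣ}
    (h : unitOrderHom E x = unitOrderHom E y) :
    leadingCoeffRatio β χ E n x = leadingCoeffRatio β χ E n y := by
  have h1 : unitOrderHom E (x / y) = 1 := by rw [map_div, h, div_self']
  have h2 : ((x / y : Eˣ) : HahnSeries ℤ F).order = 0 := h1
  have h3 : leadingCoeffRatio β χ E n (x / y) = 1 := by
    refine mul_right_cancel₀ (b := ((x / y : Eˣ) : HahnSeries ℤ F).leadingCoeff) (by simp) ?_
    rw [leadingCoeffRatio_mul_leadingCoeff, twistHom_leadingCoeff, h2, zpow_zero, Units.val_one,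
      map_one, hn _ (leadingCoeff_mem_residueSubfield (SetLike.coe_mem _) h2)]
  rw [← div_mul_cancel x y, map_mul, h3, one_mul]

theorem exists_unitOrderHom_generator (E : IntermediateField K (HahnSeries ℤ F)) :
    ∃ e : Eˣ, ∀ x, ∃ j : ℤ, unitOrderHom E (e ^ j) = unitOrderHom E x := by
  obtain ⟨⟨_, e, rfl⟩, he⟩ := IsCyclic.exists_generator (α := (unitOrderHom E).range)
  refine ⟨e, fun x => ?_⟩
  obtain ⟨j, hj⟩ := Subgroup.mem_zpowers_iff.mp (he ⟨_, x, rfl⟩)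
  exact ⟨j, (map_zpow _ _ _).trans (congrArg Subtype.val hj)⟩

/-- The image of a non-zero element under the action of `g`. -/
def twistUnit (hE : ∀ g, ∀ x ∈ E, twistHom β χ g x ∈ E) (g : G) (x : Eˣ) : Eˣ :=
  Units.mk0 ⟨twistHom β χ g x, hE g _ (SetLike.coe_mem _)⟩ fun h =>
    (map_ne_zero (twistHom β χ g)).mpr (by simp : ((x : E) : HahnSeries ℤ F) ≠ 0)
      (congrArg Subtype.val h)

theorem unitOrderHom_twistUnit (hE : ∀ g, ∀ x ∈ E, twistHom β χ g x ∈ E) (g : G) (x : Eˣ) :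
    unitOrderHom E (twistUnit hE g x) = unitOrderHom E x :=
  congrArg Multiplicative.ofAdd (twistHom_order β χ g _)

theorem leadingCoeffRatio_mul (hE : ∀ g, ∀ x ∈ E, twistHom β χ g x ∈ E) {n : G}
    (hn : n ∈ inertia β E) (m : G) (x : Eˣ) :
    leadingCoeffRatio β χ E (n * m) x =
      leadingCoeffRatio β χ E n x * leadingCoeffRatio β χ E m x := by
  refine mul_right_cancel₀ (b := (x : HahnSeries ℤ F).leadingCoeff) (by simp) ?_
  rw [mul_assoc, leadingCoeffRatio_mul_leadingCoeff, leadingCoeffRatio_mul_leadingCoeff,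
    ← leadingCoeffRatio_congr hn (unitOrderHom_twistUnit hE m x), twistHom_mul]
  exact (leadingCoeffRatio_mul_leadingCoeff n (twistUnit hE m x)).symm

theorem leadingCoeffRatio_conj (hE : ∀ g, ∀ x ∈ E, twistHom β χ g x ∈ E) {n : G}
    (hn : n ∈ inertia β E) (g : G) (x : Eˣ) :
    leadingCoeffRatio β χ E (g * n * g⁻¹) x = β g (leadingCoeffRatio β χ E n x) := by
  refine mul_right_cancel₀ (b := (x : HahnSeries ℤ F).leadingCoeff) (by simp) ?_
  have h := leadingCoeffRatio_mul_leadingCoeff (β := β) (χ := χ) n (twistUnit hE g⁻¹ x)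
  rw [leadingCoeffRatio_congr hn (unitOrderHom_twistUnit hE g⁻¹ x)] at h
  change leadingCoeffRatio β χ E n x * (twistHom β χ g⁻¹ x).leadingCoeff =
    (twistHom β χ n (twistHom β χ g⁻¹ x)).leadingCoeff at h
  rw [leadingCoeffRatio_mul_leadingCoeff, mul_assoc, twistHom_mul, twistHom_leadingCoeff,
    twistHom_mul, ← h, map_mul, mul_left_comm, twistHom_order, ← twistHom_leadingCoeff,
    ← twistHom_mul, mul_inv_cancel, twistHom_one]

theorem leadingCoeffRatio_one (x : Eˣ) : leadingCoeffRatio β χ E 1 x = 1 := by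
  change (twistHom β χ 1 x).leadingCoeff / _ = 1
  rw [twistHom_one]
  exact div_self (by simp)

theorem exists_inertia_eq_zpowers [Finite G]
    (hchar : ringChar K = 0 ∨ (ringChar K ≠ 0 ∧
      ∀ H : Subgroup G, H.Normal → IsPGroup (ringChar K) H → H = ⊥))
    (hroots : ∀ (a : F) (n : ℕ), 0 < n → a ^ n = 1 → ∃ c : K, algebraMap K F c = a)
    (hE : ∀ g, ∀ x ∈ E, twistHom β χ g x ∈ E)
    (hfaithful : ∀ g, g ≠ 1 → ∃ x ∈ E, twistHom β χ g x ≠ x) :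
    ∃ τ ∈ Subgroup.center G, inertia β E = Subgroup.zpowers τ ∧
      ∃ ζ : K, IsPrimitiveRoot ζ (orderOf τ) := by
  obtain ⟨e, he⟩ := exists_unitOrderHom_generator E
  let θ : inertia β E →* F :=
    { toFun := fun n => leadingCoeffRatio β χ E n e
      map_one' := leadingCoeffRatio_one e
      map_mul' := fun n m => leadingCoeffRatio_mul hE n.2 m e }
  have hθ : Function.Injective θ := by
    refine (injective_iff_map_eq_one θ).mpr fun n hn => Subtype.ext ?_
    have hmem : (n : G) ∈ wildInertia β χ E hE := by
      intro x hx
      by_cases hx0 : x = 0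
      · simp [hx0]
      have hx1 : (⟨x, hx⟩ : E) ≠ 0 := fun h => hx0 (congrArg Subtype.val h)
      obtain ⟨j, hj⟩ := he (Units.mk0 _ hx1)
      have h1 := leadingCoeffRatio_congr (χ := χ) n.2 hj
      have h2 : leadingCoeffRatio β χ E n (e ^ j) = 1 := by
        have : leadingCoeffRatio β χ E n e = 1 := hn
        obtain ⟨k, rfl | rfl⟩ := j.eq_nat_or_neg
        · rw [zpow_natCast, map_pow, this, one_pow]
        · rw [zpow_neg, zpow_natCast, ← mul_one (leadingCoeffRatio β χ E n (e ^ k)⁻¹),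
            ← one_pow k, ← this, ← map_pow, ← map_mul, inv_mul_cancel, map_one, map_pow, this,
            one_pow]
      have h3 := leadingCoeffRatio_mul_leadingCoeff (β := β) (χ := χ) n (Units.mk0 _ hx1)
      rw [← h1, h2, one_mul] at h3
      exact h3.symm
    rw [wildInertia_eq_bot hchar] at hmem
    · exact Subgroup.mem_bot.mp hmem
    · exact hfaithful
  have hθK : ∀ n, ∃ c : K, algebraMap K F c = θ n := fun n =>
    hroots _ (orderOf n) (orderOf_pos n) (by rw [← map_pow, pow_orderOf_eq_one, map_one])
  have := isCyclic_of_injective_ringHom θ hθ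
  obtain ⟨τ, hτ⟩ := IsCyclic.exists_generator (α := inertia β E)
  obtain ⟨ζ, hζ⟩ := hθK τ
  refine ⟨τ, Subgroup.mem_center_iff.mpr fun g => ?_, ?_, ζ, ?_⟩
  · have hconj : g * τ * g⁻¹ ∈ inertia β E := (inertia_normal hE).conj_mem _ τ.2 g
    have h : θ ⟨_, hconj⟩ = θ τ := by
      refine (leadingCoeffRatio_conj hE τ.2 g e).trans ?_
      change β g (θ τ) = θ τ
      rw [← hζ, AlgEquiv.commutes]
    exact mul_inv_eq_iff_eq_mul.mp (congrArg Subtype.val (hθ h))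
  · ext n
    refine ⟨fun hn => ?_, fun hn => Subgroup.zpowers_le.mpr τ.2 hn⟩
    obtain ⟨j, hj⟩ := Subgroup.mem_zpowers_iff.mp (hτ ⟨n, hn⟩)
    exact Subgroup.mem_zpowers_iff.mpr ⟨j, congrArg Subtype.val hj⟩
  · refine IsPrimitiveRoot.of_map_of_injective (f := algebraMap K F) ?_ (algebraMap K F).injective
    rw [hζ, Subgroup.orderOf_coe, ← orderOf_injective θ hθ]
    exact IsPrimitiveRoot.orderOf _

theorem exists_order_ne_zero [Finite G]
    (hchar : ringChar K = 0 ∨ (ringChar K ≠ 0 ∧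
      ∀ H : Subgroup G, H.Normal → IsPGroup (ringChar K) H → H = ⊥))
    (hE : ∀ g, ∀ x ∈ E, twistHom β χ g x ∈ E)
    (hfaithful : ∀ g, g ≠ 1 → ∃ x ∈ E, twistHom β χ g x ≠ x) {σ : G} (hσ : β σ = 1)
    (hσ1 : σ ≠ 1) : ∃ x ∈ E, x.order ≠ 0 := by
  by_contra! h
  refine hσ1 (Subgroup.mem_bot.mp ((wildInertia_eq_bot hchar hE hfaithful).le fun x hx => ?_))
  rw [twistHom_leadingCoeff, h x hx, hσ]
  simp

end Inertia

theorem exists_algebraMap_eq_of_pow_eq_one {K : Type*} [Field K] {S : Type*} (a : FnField K S)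
    (n : ℕ) (hn : 0 < n) (ha : a ^ n = 1) : ∃ c : K, algebraMap K (FnField K S) c = a := by
  have hint : IsIntegral (MvPolynomial S K) a := .of_pow hn (ha ▸ isIntegral_one)
  obtain ⟨f, rfl⟩ := IsIntegrallyClosed.isIntegral_iff.mp hint
  have hf : f ^ n = 1 := IsFractionRing.injective (MvPolynomial S K) (FnField K S) (by
    rw [map_pow, ha, map_one])
  obtain ⟨c, -, rfl⟩ := MvPolynomial.isUnit_iff_eq_C_of_isReduced.mp
    (IsUnit.of_pow_eq_one hf hn.ne')
  exact ⟨c, IsScalarTower.algebraMap_apply K (MvPolynomial S K) (FnField K S) c⟩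

theorem twistHom_single {K F G : Type*} [Field K] [Field F] [Algebra K F] [Group G]
    (β : G →* (F ≃ₐ[K] F)) (χ : G →* Kˣ) (g : G) (n : ℤ) (a : F) :
    twistHom β χ g (HahnSeries.single n a) =
      HahnSeries.single n (algebraMap K F (χ g ^ n : Kˣ) * β g a) := by
  ext m
  rw [twistHom_coeff, HahnSeries.coeff_single, HahnSeries.coeff_single]
  split_ifs with h
  · rw [h]
  · rw [map_zero, mul_zero]

/-- The action of `G` on the rational function field of a quotient. -/
def quotientGalAction (K : Type*) [Field K] {G : Type*} [Group G] (N : Subgroup G) [N.Normal] :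
    G →* (FnField K (G ⧸ N) ≃ₐ[K] FnField K (G ⧸ N)) :=
  (galAction K (G ⧸ N)).comp (QuotientGroup.mk' N)

/-- The substitution of monomials for the variables indexed by pairs. -/
def monomialHom (K : Type*) [Field K] (S : Type*) (p N : ℕ) :
    MvPolynomial (S × Fin p) K →ₐ[K] Polynomial (FnField K S) :=
  MvPolynomial.aeval fun c => Polynomial.monomial (c.2 : ℕ)
    (algebraMap (MvPolynomial S K) (FnField K S) (MvPolynomial.X c.1 ^ N ^ (c.2 : ℕ)))

theorem exists_monomialHom_ne_zero {K : Type*} [Field K] {S : Type*} [Finite S] (p : ℕ)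
    {f : MvPolynomial (S × Fin p) K} (hf : f ≠ 0) : ∃ N : ℕ, monomialHom K S p N f ≠ 0 := by
  obtain ⟨N, hN⟩ := exists_aeval_X_pow_ne_zero p hf
  refine ⟨N, fun h => hN (IsFractionRing.injective (MvPolynomial S K) (FnField K S) ?_)⟩
  have hcomp : ((Polynomial.aeval (R := FnField K S) (1 : FnField K S)).restrictScalars K).comp
      (monomialHom K S p N) = (IsScalarTower.toAlgHom K (MvPolynomial S K) (FnField K S)).comp
        (MvPolynomial.aeval fun c : S × Fin p => MvPolynomial.X c.1 ^ N ^ (c.2 : ℕ)) := by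
    ext c
    simp [monomialHom]
  have h1 := DFunLike.congr_fun hcomp f
  rw [AlgHom.comp_apply, h, map_zero] at h1
  exact h1.symm.trans (map_zero _).symm

/-- The inclusion of polynomials into Laurent series. -/
def polynomialHahnHom (K F : Type*) [Field K] [Field F] [Algebra K F] :
    Polynomial F →ₐ[K] HahnSeries ℤ F :=
  (ofPowerSeriesHom K F).comp
    ((Polynomial.coeToPowerSeries.algHom (R := F) F).restrictScalars K)

theorem polynomialHahnHom_injective (K F : Type*) [Field K] [Field F] [Algebra K F] :
    Function.Injective (polynomialHahnHom K F) := fun f g h =>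
  Polynomial.coe_injective F (HahnSeries.ofPowerSeries_injective (by
    simpa [polynomialHahnHom, ofPowerSeriesHom] using h))

theorem polynomialHahnHom_monomial {K F : Type*} [Field K] [Field F] [Algebra K F] (n : ℕ)
    (a : F) : polynomialHahnHom K F (Polynomial.monomial n a) = HahnSeries.single (n : ℤ) a := by
  have h : polynomialHahnHom K F (Polynomial.monomial n a) =
    HahnSeries.ofPowerSeries ℤ F (Polynomial.monomial n a : Polynomial F) := by
    simp [polynomialHahnHom, ofPowerSeriesHom]
  rw [h, ← Polynomial.C_mul_X_pow_eq_monomial, Polynomial.coe_mul, Polynomial.coe_C,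
    Polynomial.coe_pow, Polynomial.coe_X, map_mul, HahnSeries.ofPowerSeries_C,
    HahnSeries.ofPowerSeries_X_pow, HahnSeries.C_apply, HahnSeries.single_mul_single, zero_add,
    mul_one]

theorem exists_equivariant_ne_zero {K : Type*} [Field K] {G : Type*} [Group G] [Finite G]
    (N : Subgroup G) [N.Normal] (χ : G →* Kˣ) (hχ : ∀ n ∈ N, χ n = 1 → n = 1) (p : ℕ)
    (hp : ∀ n ∈ N, n ^ p = 1) (hpK : (p : K) ≠ 0) {f : MvPolynomial G K} (hf : f ≠ 0) :
    ∃ φ : MvPolynomial G K →ₐ[K] HahnSeries ℤ (FnField K (G ⧸ N)),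
      (∀ g q, φ (MvPolynomial.rename (g * ·) q) =
        twistHom (quotientGalAction K N) χ g (φ q)) ∧ φ f ≠ 0 := by
  obtain ⟨m, hm⟩ := exists_monomialHom_ne_zero p
    ((map_ne_zero_iff _ (fourierHom_injective N χ hχ p hp hpK)).mpr hf)
  refine ⟨((polynomialHahnHom K _).comp (monomialHom K _ p m)).comp (fourierHom N χ p),
    fun g q => ?_, (map_ne_zero_iff _ (polynomialHahnHom_injective K _)).mpr hm⟩
  suffices h : (((polynomialHahnHom K _).comp (monomialHom K _ p m)).comp
      (fourierHom N χ p)).comp (MvPolynomial.rename (g * ·)) =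
      (twistHom (quotientGalAction K N) χ g).comp
        (((polynomialHahnHom K _).comp (monomialHom K _ p m)).comp (fourierHom N χ p)) from
    DFunLike.congr_fun h q
  ext1 h
  simp only [AlgHom.comp_apply, MvPolynomial.rename_X, fourierHom, MvPolynomial.aeval_X,
    map_sum, map_mul, MvPolynomial.algHom_C, AlgHom.commutes]
  refine Finset.sum_congr rfl fun i _ => ?_
  simp only [monomialHom, MvPolynomial.aeval_X, polynomialHahnHom_monomial, twistHom_single,
    algebraMap_hahnSeries, HahnSeries.single_mul_single]
  have hX : quotientGalAction K N g (algebraMap (MvPolynomial (G ⧸ N) K)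
      (FnField K (G ⧸ N)) (MvPolynomial.X (h : G ⧸ N) ^ m ^ (i : ℕ))) =
        algebraMap (MvPolynomial (G ⧸ N) K) (FnField K (G ⧸ N))
          (MvPolynomial.X ((g * h : G) : G ⧸ N) ^ m ^ (i : ℕ)) := by
    simp only [map_pow]
    exact congrArg (· ^ m ^ (i : ℕ)) (galAction_X K (g : G ⧸ N) (h : G ⧸ N))
  rw [hX, ← mul_assoc, ← map_mul (algebraMap K _), Units.val_mul, mul_pow, mul_comm (_ ^ _),
    zpow_natCast, Units.val_pow_eq_pow_val]

theorem edK_quotient_add_one_le_edK {K : Type u} [Field K] {G : Type v} [Group G] [Finite G]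
    (hchar : ringChar K = 0 ∨ (ringChar K ≠ 0 ∧
      ∀ H : Subgroup G, H.Normal → IsPGroup (ringChar K) H → H = ⊥))
    {σ : G} (hσ1 : σ ≠ 1) [(Subgroup.zpowers σ).Normal] (χ : G →* Kˣ)
    (hχ : ∀ n ∈ Subgroup.zpowers σ, χ n = 1 → n = 1) (hσK : (orderOf σ : K) ≠ 0)
    (hroot : ∀ τ ∈ Subgroup.center G, Subgroup.zpowers σ < Subgroup.zpowers τ →
      ¬ ∃ ζ : K, IsPrimitiveRoot ζ (orderOf τ)) :
    edK K (G ⧸ Subgroup.zpowers σ) + 1 ≤ edK K G := by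
  obtain ⟨E₀, hstable, hfaithful, hE₀⟩ := exists_trdeg_eq_edK K G
  set β := quotientGalAction K (Subgroup.zpowers σ)
  obtain ⟨E, hE, hEf, hEle⟩ := exists_specialization (fun g => twistHom β χ g)
    (fun f hf => exists_equivariant_ne_zero (Subgroup.zpowers σ) χ hχ (orderOf σ)
      (fun n hn => orderOf_dvd_iff_pow_eq_one.mp (orderOf_dvd_of_mem_zpowers hn)) hσK hf)
    E₀ hstable hfaithful
  have hβσ : β σ = 1 := by
    change galAction K _ (QuotientGroup.mk σ) = 1
    rw [(QuotientGroup.eq_one_iff σ).mpr (Subgroup.mem_zpowers σ), map_one]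
  obtain ⟨t, ht, ht0⟩ := exists_order_ne_zero hchar hE hEf hβσ hσ1
  obtain ⟨τ, hτ, hI, hζ⟩ := exists_inertia_eq_zpowers hchar exists_algebraMap_eq_of_pow_eq_one
    hE hEf
  have hle : Subgroup.zpowers σ ≤ Subgroup.zpowers τ := by
    rw [← hI, Subgroup.zpowers_le]
    intro a _
    rw [hβσ, AlgEquiv.one_apply]
  have hI' : inertia β E = Subgroup.zpowers σ :=
    hI.trans (hle.eq_of_not_lt fun hlt => hroot τ hτ hlt hζ).symm
  have hed : (edK K (G ⧸ Subgroup.zpowers σ) : Cardinal) ≤ trdeg K (residueSubfield E) := by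
    refine edK_le_trdeg _ (fun g a ha => ?_) (fun g hg => ?_)
    · obtain ⟨g, rfl⟩ := QuotientGroup.mk_surjective g
      exact residueSubfield_stable β χ (hE g) ha
    · obtain ⟨g, rfl⟩ := QuotientGroup.mk_surjective g
      have : g ∉ inertia β E := by rwa [hI', ← QuotientGroup.eq_one_iff]
      by_contra! h
      exact this h
  have h := (add_le_add_left hed 1).trans
    ((trdeg_residueSubfield_add_one_le E ht ht0).trans (hEle.trans hE₀.le))
  exact_mod_cast h

/-- Theorem 4.5 (central extension theorem): let `p` be a prime, `G` a finite group, and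
`K` a field such that (i) `char K = 0`, or `char K = l > 0` and `G` has no non-trivial
normal `l`-subgroup; (ii) there is a central element `σ ∈ Z(G)` of order `p`; (iii)
there is a linear character `χ : G → K^×` with `χ(σ) ≠ 1`; (iv) for every `τ ∈ Z(G)` of
order `m` with `⟨σ⟩` a proper subgroup of `⟨τ⟩`, `K` contains no primitive `m`-th root
of unity.  Then `ed_K(G) = ed_K(G/⟨σ⟩) + 1`. -/
theorem edK_central_extension (K : Type*) [Field K] (G : Type*) [Group G] [Finite G]
    (p : ℕ) (hp : p.Prime)
    (hchar : ringChar K = 0 ∨ (ringChar K ≠ 0 ∧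
      ∀ H : Subgroup G, H.Normal → IsPGroup (ringChar K) H → H = ⊥))
    (σ : G) (hσ : σ ∈ Subgroup.center G) (hordσ : orderOf σ = p)
    (χ : G →* Kˣ) (hχ : χ σ ≠ 1)
    (hroot : ∀ τ ∈ Subgroup.center G, Subgroup.zpowers σ < Subgroup.zpowers τ →
      ¬ ∃ ζ : K, IsPrimitiveRoot ζ (orderOf τ)) :
    haveI : (Subgroup.zpowers σ).Normal := by
      constructor
      intro n hn g
      have hc : g * n = n * g :=
        Subgroup.mem_center_iff.mp (Subgroup.zpowers_le.mpr hσ hn) g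
      rw [hc, mul_assoc, mul_inv_cancel, mul_one]
      exact hn
    edK K G = edK K (G ⧸ Subgroup.zpowers σ) + 1 := by
  have : (Subgroup.zpowers σ).Normal := by
    constructor
    intro n hn g
    have hc : g * n = n * g :=
      Subgroup.mem_center_iff.mp (Subgroup.zpowers_le.mpr hσ hn) g
    rw [hc, mul_assoc, mul_inv_cancel, mul_one]
    exact hn
  have := Fact.mk hp
  have hσ1 : σ ≠ 1 := fun h => hχ (by rw [h, map_one])
  have hχσ : orderOf (χ σ) = p :=
    orderOf_eq_prime (by rw [← map_pow, ← hordσ, pow_orderOf_eq_one, map_one]) hχ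
  have hinj : ∀ n ∈ Subgroup.zpowers σ, χ n = 1 → n = 1 := by
    rintro _ ⟨k, rfl⟩ hk
    simp only [map_zpow] at hk ⊢
    rw [← orderOf_dvd_iff_zpow_eq_one, hχσ] at hk
    rwa [← orderOf_dvd_iff_zpow_eq_one, hordσ]
  have hpK : (orderOf σ : K) ≠ 0 := fun h => hχ <| by
    rw [hordσ] at h
    have := CharP.ringChar_of_prime_eq_zero hp h
    have : CharP K p := this ▸ ringChar.charP K
    have h1 : (χ σ : K) ^ p = 1 := by
      rw [← Units.val_pow_eq_pow_val, ← hχσ, pow_orderOf_eq_one, Units.val_one]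
    exact Units.ext (frobenius_inj K p (by simpa [frobenius_def] using h1))
  exact le_antisymm (edK_le_edK_quotient_add_one _ χ hinj)
    (edK_quotient_add_one_le_edK hchar hσ1 χ hinj hpK hroot)
end
end
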